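/- arXiv:1609.06947 — 2 statements merged into one kernel-verified Lean document; each statement's English description precedes it below -/
import Mathlib

section
/- For every natural number s ≥ 1 the consecutive determinants D_s satisfy the ratio identity (s+1)^2 · C(4s+3, 2s+1) · C(4s+1, 2s) · D_{s+1} = 2^{8s} · D_s. -/
/-- The determinant `D_s = det( 1/((2j)² - (2k-1)²) )_{1 ≤ j,k ≤ s}` (here `j = j.1 + 1`,
`k = k.1 + 1` for `j k : Fin s`), a rational number. -/
def Ddet (s : ℕ) : ℚ :=
  Matrix.det (Matrix.of fun j k : Fin s =>
    1 / ((2 * (j.1 : ℚ) + 2) ^ 2 - (2 * (k.1 : ℚ) + 1) ^ 2))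

/-- Schur complement recursion for Cauchy determinants: splitting off the last row and column. -/
theorem det_cauchy_succ {K : Type*} [Field K] (n : ℕ) (x y : ℕ → K)
    (h : ∀ i j, x i - y j ≠ 0) :
    (Matrix.of fun i j : Fin (n + 1) => 1 / (x i - y j)).det =
      1 / (x n - y n) *
        (∏ i ∈ Finset.range n, (x i - x n) * (y n - y i) / ((x i - y n) * (x n - y i))) *
        (Matrix.of fun i j : Fin n => 1 / (x i - y j)).det := by
  have hblocks : (Matrix.of fun i j : Fin (n + 1) => 1 / (x i - y j)).submatrix
      finSumFinEquiv finSumFinEquiv = Matrix.fromBlocks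
        (Matrix.of fun i j : Fin n => 1 / (x i - y j))
        (Matrix.of fun (i : Fin n) (_ : Fin 1) => 1 / (x i - y n))
        (Matrix.of fun (_ : Fin 1) (j : Fin n) => 1 / (x n - y j))
        (Matrix.diagonal fun _ : Fin 1 => 1 / (x n - y n)) := by
    ext i j
    rcases i with i | i <;> rcases j with j | j <;> simp [Fin.fin_one_eq_zero]
  let _ : Invertible (fun _ : Fin 1 => 1 / (x n - y n)) :=
    ⟨fun _ => x n - y n, by ext; simp [h n n], by ext; simp [h n n]⟩
  let _ : Invertible (Matrix.diagonal fun _ : Fin 1 => 1 / (x n - y n)) :=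
    Matrix.diagonalInvertible _
  have hschur : (Matrix.of fun i j : Fin n => 1 / (x i - y j)) -
      (Matrix.of fun (i : Fin n) (_ : Fin 1) => 1 / (x i - y n)) *
        ⅟(Matrix.diagonal fun _ : Fin 1 => 1 / (x n - y n)) *
        (Matrix.of fun (_ : Fin 1) (j : Fin n) => 1 / (x n - y j)) =
      Matrix.of fun i j : Fin n => (x i - x n) / (x i - y n) *
        (Matrix.of fun i j : Fin n => (y n - y j) / (x n - y j) *
          (Matrix.of fun i j : Fin n => 1 / (x i - y j)) i j) i j := by
    have hinv : ⅟(Matrix.diagonal fun _ : Fin 1 => 1 / (x n - y n)) =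
        Matrix.diagonal fun _ : Fin 1 => x n - y n := rfl
    ext i j
    rw [hinv]
    simp only [Matrix.sub_apply, Matrix.mul_apply, Matrix.of_apply,
      Finset.univ_unique, Finset.sum_singleton, Matrix.diagonal_apply_eq]
    have h1 := h i j
    have h2 := h i n
    have h3 := h n j
    field_simp
    ring
  rw [← Matrix.det_submatrix_equiv_self finSumFinEquiv, hblocks, Matrix.det_fromBlocks₂₂, hschur,
    Matrix.det_mul_column, Matrix.det_mul_row, Matrix.det_diagonal,
    Fin.prod_univ_eq_prod_range (fun i => (x i - x n) / (x i - y n)),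
    Fin.prod_univ_eq_prod_range (fun i => (y n - y i) / (x n - y i))]
  simp only [mul_div_mul_comm, Finset.prod_mul_distrib]
  simp
  ring

theorem prod_range_sub_cast (n : ℕ) :
    ∏ i ∈ Finset.range n, ((n : ℚ) - i) = n.factorial := by
  induction n with
  | zero => simp
  | succ n ih =>
    rw [Finset.prod_range_succ', Nat.factorial_succ]
    push_cast
    rw [← ih]
    simp only [add_sub_add_right_eq_sub]
    ring

theorem prod_range_add_cast (n m : ℕ) :
    (∏ i ∈ Finset.range m, ((n : ℚ) + i + 1)) * n.factorial = (n + m).factorial := by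
  induction m with
  | zero => simp
  | succ m ih =>
    rw [Finset.prod_range_succ, ← add_assoc, Nat.factorial_succ]
    push_cast
    rw [← ih]
    ring

theorem prod_range_odd_sub_one (n : ℕ) :
    (∏ i ∈ Finset.range n, (2 * (n : ℚ) - 2 * i - 1)) * (2 ^ n * n.factorial) =
      (2 * n).factorial := by
  induction n with
  | zero => simp
  | succ n ih =>
    rw [Finset.prod_range_succ', show 2 * (n + 1) = 2 * n + 1 + 1 by ring,
      Nat.factorial_succ, Nat.factorial_succ, Nat.factorial_succ]
    push_cast
    rw [← ih]
    have : ∀ i : ℕ, 2 * ((n : ℚ) + 1) - 2 * (i + 1) - 1 = 2 * n - 2 * i - 1 := by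
      intro i; ring
    simp only [this]
    ring

theorem prod_range_odd_add_one (n : ℕ) :
    (∏ i ∈ Finset.range n, (2 * (n : ℚ) - 2 * i + 1)) * (2 ^ n * n.factorial) =
      (2 * n + 1).factorial := by
  induction n with
  | zero => simp
  | succ n ih =>
    rw [Finset.prod_range_succ', show 2 * (n + 1) + 1 = 2 * n + 1 + 1 + 1 by ring,
      Nat.factorial_succ (2 * n + 1 + 1), Nat.factorial_succ (2 * n + 1), Nat.factorial_succ n]
    push_cast
    rw [← ih]
    have : ∀ i : ℕ, 2 * ((n : ℚ) + 1) - 2 * (i + 1) + 1 = 2 * n - 2 * i + 1 := by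
      intro i; ring
    simp only [this]
    ring

theorem prod_range_odd_shift (n m : ℕ) :
    (∏ i ∈ Finset.range m, (2 * (n : ℚ) + 2 * i + 3)) *
      (2 ^ m * (n + m + 1).factorial * (2 * n + 2).factorial) =
      (2 * n + 2 * m + 2).factorial * (n + 1).factorial := by
  induction m with
  | zero => simp; ring
  | succ m ih =>
    rw [Finset.prod_range_succ, show 2 * n + 2 * (m + 1) + 2 = 2 * n + 2 * m + 2 + 1 + 1 by ring,
      ← add_assoc n m 1, Nat.factorial_succ (n + m + 1), Nat.factorial_succ (2 * n + 2 * m + 2 + 1),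
      Nat.factorial_succ (2 * n + 2 * m + 2)]
    push_cast
    linear_combination (2 * (n : ℚ) + 2 * m + 3) * (2 * n + 2 * m + 4) * ih

theorem sq_even_sub_sq_odd_ne_zero (i j : ℕ) :
    (2 * (i : ℚ) + 2) ^ 2 - (2 * (j : ℚ) + 1) ^ 2 ≠ 0 := by
  intro h
  have h' : (2 * (i : ℤ) + 2) ^ 2 - (2 * (j : ℤ) + 1) ^ 2 = 0 := by exact_mod_cast h
  ring_nf at h'
  omega

/-- The ratio identity `(s+1)² · C(4s+3, 2s+1) · C(4s+1, 2s) · D_{s+1} = 2^{8s} · D_s`. -/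
theorem Ddet_ratio (s : ℕ) (hs : 1 ≤ s) :
    ((s : ℚ) + 1) ^ 2 * (Nat.choose (4 * s + 3) (2 * s + 1) : ℚ) *
      (Nat.choose (4 * s + 1) (2 * s) : ℚ) * Ddet (s + 1) =
    2 ^ (8 * s) * Ddet s := by
  have hrec := det_cauchy_succ s (fun i => (2 * (i : ℚ) + 2) ^ 2) (fun j => (2 * (j : ℚ) + 1) ^ 2)
    sq_even_sub_sq_odd_ne_zero
  have hterm : ∀ i : ℕ, ((2 * (i : ℚ) + 2) ^ 2 - (2 * (s : ℚ) + 2) ^ 2) *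
      ((2 * (s : ℚ) + 1) ^ 2 - (2 * (i : ℚ) + 1) ^ 2) /
      (((2 * (i : ℚ) + 2) ^ 2 - (2 * (s : ℚ) + 1) ^ 2) *
        ((2 * (s : ℚ) + 2) ^ 2 - (2 * (i : ℚ) + 1) ^ 2)) =
      16 * ((s : ℚ) - i) * (s - i) * (((s + 1 : ℕ) : ℚ) + i + 1) * (s + i + 1) /
      ((2 * s - 2 * i - 1) * (2 * s - 2 * i + 1) * (2 * s + 2 * i + 3) * (2 * s + 2 * i + 3)) := by
    intro i
    rw [← neg_div_neg_eq]
    push_cast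
    congr 1 <;> ring
  simp only [hterm, Finset.prod_div_distrib, Finset.prod_mul_distrib] at hrec
  unfold Ddet
  rw [hrec, ← mul_assoc]
  congr 1
  have hP := prod_range_sub_cast s
  have hQ := prod_range_add_cast s s
  have hR := prod_range_add_cast (s + 1) s
  have hA := prod_range_odd_sub_one s
  have hB := prod_range_odd_add_one s
  have hC := prod_range_odd_shift s s
  have fac_ne : ∀ k : ℕ, (k.factorial : ℚ) ≠ 0 := fun k => by exact_mod_cast k.factorial_ne_zero
  rw [← eq_div_iff (by simp [fac_ne])] at hQ hR hA hB hC
  rw [hP, hQ, hR, hA, hB, hC, Nat.cast_choose ℚ (by omega), Nat.cast_choose ℚ (by omega),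
    show 4 * s + 3 - (2 * s + 1) = 2 * s + 1 + 1 by omega,
    show 4 * s + 1 - 2 * s = 2 * s + 1 by omega,
    show 2 * s + 2 * s + 2 = 4 * s + 1 + 1 by omega,
    show 4 * s + 3 = 4 * s + 1 + 1 + 1 by omega,
    show s + 1 + s = 2 * s + 1 by omega, show s + s = 2 * s by omega,
    Nat.factorial_succ (4 * s + 1 + 1), Nat.factorial_succ (4 * s + 1),
    Nat.factorial_succ (2 * s + 1), Nat.factorial_succ (2 * s), Nat.factorial_succ s,
    Finset.prod_const, Finset.card_range, pow_mul]
  have h1 := fac_ne s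
  have h2 := fac_ne (2 * s)
  have h3 := fac_ne (4 * s + 1)
  have h4 : (2 * (s : ℚ) + 2) ^ 2 - (2 * s + 1) ^ 2 = 4 * s + 3 := by ring
  have h5 : (4 * (s : ℚ) + 3) ≠ 0 := by positivity
  rw [h4, show (16 : ℚ) ^ s = (2 ^ s) ^ 4 by rw [← pow_mul, mul_comm, pow_mul]; norm_num,
    show ((2 : ℚ) ^ 8) ^ s = (2 ^ s) ^ 8 by rw [← pow_mul, ← pow_mul, mul_comm]]
  push_cast
  generalize (2 : ℚ) ^ s = t at *
  field_simp
  ring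
end

section
/- Let t ≥ 1 and r = 2t, and let n'_1, n'_2, …, n'_r be distinct positive integers such that n'_1 < n'_3 < ⋯ < n'_{2t−1} are odd and n'_2 < n'_4 < ⋯ < n'_{2t} are even. Then the iterated integral over the ordered simplex −1 ≤ ξ_1 ≤ ξ_2 ≤ ⋯ ≤ ξ_r ≤ 1 of det( ξ_k^{n'_j − 1} )_{1≤j,k≤r} equals 2^r · det( 1/( n'_{2k−1} · (n'_{2j} + n'_{2k−1}) ) )_{1≤j,k≤t}. -/
open MeasureTheory

open Equiv in
/-- The signed sum over pairings does not change when the kernel at one position is modified by a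
symmetric kernel. -/
theorem sum_sign_mul_prod_update {ι R : Type*} [Fintype ι] [DecidableEq ι] [CommRing R]
    [NoZeroDivisors R] [CharZero R]
    (G : ι → ι ⊕ ι → ι ⊕ ι → R) (k : ι) (N : ι ⊕ ι → ι ⊕ ι → R)
    (h : ∀ i j, G k i j - G k j i = N i j - N j i) :
    ∑ σ : Perm (ι ⊕ ι), (Perm.sign σ : R) *
        ∏ l, Function.update G k N l (σ (Sum.inl l)) (σ (Sum.inr l)) =
      ∑ σ : Perm (ι ⊕ ι), (Perm.sign σ : R) * ∏ l, G l (σ (Sum.inl l)) (σ (Sum.inr l)) := by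
  rw [← sub_eq_zero, ← Finset.sum_sub_distrib, ← self_eq_neg, ← Finset.sum_neg_distrib]
  refine Fintype.sum_equiv (Equiv.mulRight (swap (Sum.inl k) (Sum.inr k))) _ _ fun σ => ?_
  have hprod : ∀ τ : Perm (ι ⊕ ι),
      ∏ l ∈ Finset.univ.erase k, Function.update G k N l (τ (Sum.inl l)) (τ (Sum.inr l)) =
        ∏ l ∈ Finset.univ.erase k, G l (τ (Sum.inl l)) (τ (Sum.inr l)) := fun τ =>
    Finset.prod_congr rfl fun l hl => by
      rw [Function.update_of_ne (Finset.ne_of_mem_erase hl)]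
  have hswap :
      ∏ l ∈ Finset.univ.erase k, G l ((σ * swap (Sum.inl k) (Sum.inr k)) (Sum.inl l))
          ((σ * swap (Sum.inl k) (Sum.inr k)) (Sum.inr l)) =
        ∏ l ∈ Finset.univ.erase k, G l (σ (Sum.inl l)) (σ (Sum.inr l)) :=
    Finset.prod_congr rfl fun l hl => by
      have hne := Finset.ne_of_mem_erase hl
      simp only [Perm.mul_apply]
      rw [swap_apply_of_ne_of_ne (by simpa using hne) (by simp),
        swap_apply_of_ne_of_ne (by simp) (by simpa using hne)]
  simp only [Equiv.coe_mulRight, ← Finset.mul_prod_erase Finset.univ _ (Finset.mem_univ k),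
    hprod, hswap, Function.update_self]
  simp only [Perm.mul_apply, swap_apply_left, swap_apply_right, Perm.sign_mul,
    Perm.sign_swap (Sum.inl_ne_inr (a := k) (b := k))]
  push_cast
  linear_combination (-(Perm.sign σ : R) *
    ∏ l ∈ Finset.univ.erase k, G l (σ (Sum.inl l)) (σ (Sum.inr l))) *
      h (σ (Sum.inl k)) (σ (Sum.inr k))

open Equiv in
/-- The signed sum over pairings depends only on the antisymmetric part of the kernel. -/
theorem sum_sign_mul_prod_eq_of_sub_swap_eq {ι R : Type*} [Fintype ι] [DecidableEq ι]
    [CommRing R] [NoZeroDivisors R] [CharZero R] (M N : ι ⊕ ι → ι ⊕ ι → R)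
    (h : ∀ i j, M i j - M j i = N i j - N j i) :
    ∑ σ : Perm (ι ⊕ ι), (Perm.sign σ : R) * ∏ l, N (σ (Sum.inl l)) (σ (Sum.inr l)) =
      ∑ σ : Perm (ι ⊕ ι), (Perm.sign σ : R) * ∏ l, M (σ (Sum.inl l)) (σ (Sum.inr l)) := by
  have key : ∀ s : Finset ι,
      ∑ σ : Perm (ι ⊕ ι), (Perm.sign σ : R) *
          ∏ l, s.piecewise (fun _ => N) (fun _ => M) l (σ (Sum.inl l)) (σ (Sum.inr l)) =
        ∑ σ : Perm (ι ⊕ ι), (Perm.sign σ : R) * ∏ l, M (σ (Sum.inl l)) (σ (Sum.inr l)) := by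
    intro s
    induction s using Finset.induction_on with
    | empty => simp
    | insert k s hk ih =>
      rw [Finset.piecewise_insert, sum_sign_mul_prod_update, ih]
      intro i j
      rw [Finset.piecewise_eq_of_notMem _ _ _ hk]
      exact h i j
  simpa using key Finset.univ

open Equiv in
/-- For a kernel supported on pairs in `Sum.inl × Sum.inr`, the signed sum over pairings is a
multiple of a determinant. -/
theorem sum_sign_mul_prod_eq_factorial_mul_det {ι R : Type*} [Fintype ι] [DecidableEq ι]
    [CommRing R] (N : ι ⊕ ι → ι ⊕ ι → R)
    (hinr : ∀ i j, N (Sum.inr i) j = 0) :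
    ∑ σ : Perm (ι ⊕ ι), (Perm.sign σ : R) * ∏ l, N (σ (Sum.inl l)) (σ (Sum.inr l)) =
      (Fintype.card ι).factorial *
        Matrix.det (Matrix.of fun i j : ι => N (Sum.inl i) (Sum.inr j)) := by
  set B : Matrix ι ι R := Matrix.of fun i j => N (Sum.inl i) (Sum.inr j) with hB
  have hsum := Fintype.sum_of_injective (Perm.sumCongrHom ι ι) Perm.sumCongrHom_injective
    (fun p : Perm ι × Perm ι => (Perm.sign p.1 : R) * ((Perm.sign p.2 : R) *
      ∏ l, B (p.1 l) (p.2 l)))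
    (fun σ => (Perm.sign σ : R) * ∏ l, N (σ (Sum.inl l)) (σ (Sum.inr l)))
    (fun σ hσ => ?_) (fun p => ?_)
  · rw [← hsum, Fintype.sum_prod_type]
    have hα : ∀ α : Perm ι, ∑ β : Perm ι, (Perm.sign α : R) * ((Perm.sign β : R) *
        ∏ l, B (α l) (β l)) = B.det := fun α => by
      have hd : ∑ β : Perm ι, (Perm.sign β : R) * ∏ l, B (α l) (β l) =
          (B.submatrix α id).det := by
        rw [← Matrix.det_transpose, Matrix.det_apply']
        rfl
      rw [← Finset.mul_sum, hd, Matrix.det_permute, ← mul_assoc, ← Int.cast_mul,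
        ← Units.val_mul, Int.units_mul_self, Units.val_one, Int.cast_one, one_mul]
    simp_rw [hα]
    simp [Fintype.card_perm]
  · have h1 : ¬∀ x, ∃ y, Sum.inl y = σ (Sum.inl x) := fun h =>
      hσ (Perm.mem_sumCongrHom_range_of_perm_mapsTo_inl
        (by rintro _ ⟨x, rfl⟩; exact h x))
    obtain ⟨a, ha⟩ := not_forall.mp h1
    rcases hx : σ (Sum.inl a) with a2 | b
    · exact absurd ⟨a2, hx.symm⟩ ha
    · rw [Finset.prod_eq_zero (Finset.mem_univ a), mul_zero]
      rw [hx, hinr]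
  · simp [Perm.sign_sumCongr, hB, mul_assoc]

open Equiv in
/-- Integrating each column that depends on its own variable inside a determinant. -/
theorem integral_det_fromCols {ι : Type*} [Fintype ι] [DecidableEq ι] (μ : ι → Measure ℝ)
    [∀ k, SigmaFinite (μ k)] (f : ι ⊕ ι → ℝ → ℝ) (hf : ∀ i k, Integrable (f i) (μ k))
    (C : Matrix (ι ⊕ ι) ι ℝ) :
    ∫ x, Matrix.det (Matrix.fromCols (Matrix.of fun i k => f i (x k)) C) ∂Measure.pi μ =
      Matrix.det (Matrix.fromCols (Matrix.of fun i k => ∫ u, f i u ∂μ k) C) := by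
  simp only [Matrix.det_apply', Fintype.prod_sum_type, Matrix.fromCols_apply_inl,
    Matrix.fromCols_apply_inr, Matrix.of_apply]
  rw [integral_finsetSum]
  · simp only [integral_const_mul, integral_mul_const]
    refine Finset.sum_congr rfl fun σ _ => ?_
    rw [integral_fintype_prod_eq_prod (fun k u => f (σ (Sum.inl k)) u)]
  · intro σ _
    exact ((Integrable.fintype_prod_dep (f := fun k u => f (σ (Sum.inl k)) u)
      fun k => hf _ k).mul_const _).const_mul _

open Equiv in
/-- The integral of a determinant in which each variable occurs in two columns. -/
theorem integral_det_fromCols_pair {ι : Type*} [Fintype ι] [DecidableEq ι] (μ : Measure ℝ)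
    [SigmaFinite μ] (f g : ι ⊕ ι → ℝ → ℝ)
    (hfg : ∀ i j, Integrable (fun u => f i u * g j u) μ) :
    ∫ y, Matrix.det (Matrix.fromCols (Matrix.of fun i k => f i (y k))
        (Matrix.of fun i k => g i (y k))) ∂Measure.pi (fun _ : ι => μ) =
      ∑ σ : Perm (ι ⊕ ι), (Perm.sign σ : ℝ) *
        ∏ l, ∫ u, f (σ (Sum.inl l)) u * g (σ (Sum.inr l)) u ∂μ := by
  simp only [Matrix.det_apply', Fintype.prod_sum_type, Matrix.fromCols_apply_inl,
    Matrix.fromCols_apply_inr, Matrix.of_apply, ← Finset.prod_mul_distrib]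
  rw [integral_finsetSum]
  · refine Finset.sum_congr rfl fun σ _ => ?_
    rw [integral_const_mul,
      integral_fintype_prod_eq_prod (fun k u => f (σ (Sum.inl k)) u * g (σ (Sum.inr k)) u)]
  · intro σ _
    exact (Integrable.fintype_prod_dep
      (f := fun k u => f (σ (Sum.inl k)) u * g (σ (Sum.inr k)) u) fun k => hfg _ _).const_mul _

/-- Almost every tuple of real numbers has distinct entries. -/
theorem ae_injective_pi (n : ℕ) : ∀ᵐ y : Fin n → ℝ, Function.Injective y := by
  have h : ∀ i j : Fin n, i ≠ j → ∀ᵐ y : Fin n → ℝ, y i ≠ y j := fun i j hij => by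
    let L : (Fin n → ℝ) →ₗ[ℝ] ℝ := 
      LinearMap.proj (R := ℝ) (φ := fun _ => ℝ) i - LinearMap.proj (R := ℝ) (φ := fun _ => ℝ) j
    have hL : L.ker ≠ ⊤ := fun htop => by
      have := LinearMap.congr_fun (LinearMap.ker_eq_top.mp htop) (Pi.single i 1)
      simp [L, hij] at this
    have h0 := Measure.addHaar_submodule (volume : Measure (Fin n → ℝ)) L.ker hL
    refine measure_mono_null (fun y hy => ?_) h0
    simpa [L, sub_eq_zero] using hy
  have hall : ∀ᵐ y : Fin n → ℝ, ∀ i j : Fin n, i ≠ j → y i ≠ y j := by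
    rw [ae_all_iff]; intro i
    rw [ae_all_iff]; intro j
    by_cases hij : i = j
    · simp [hij]
    · simpa [hij] using h i j hij
  filter_upwards [hall] with y hy i j hij
  by_contra hne
  exact hy i j hne hij

/-- The integral of a symmetric function is `n!` times its integral over the monotone tuples. -/
theorem integral_eq_factorial_mul_setIntegral_monotone {n : ℕ} (g : (Fin n → ℝ) → ℝ)
    (hg : Integrable g) (hsymm : ∀ (τ : Equiv.Perm (Fin n)) y, g (y ∘ τ) = g y) :
    ∫ y, g y = n.factorial * ∫ y in {y : Fin n → ℝ | Monotone y}, g y := by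
  have hmeas : MeasurableSet {y : Fin n → ℝ | Monotone y} :=
    isClosed_monotone.measurableSet
  set h : (Fin n → ℝ) → ℝ := Set.indicator {y | Monotone y} g with hh
  have hmp : ∀ τ : Equiv.Perm (Fin n),
      MeasurePreserving (MeasurableEquiv.piCongrLeft (fun _ : Fin n => ℝ) τ) :=
    fun τ => volume_measurePreserving_piCongrLeft (fun _ => ℝ) τ
  have hcomp : ∀ (τ : Equiv.Perm (Fin n)) (y : Fin n → ℝ),
      MeasurableEquiv.piCongrLeft (fun _ : Fin n => ℝ) τ y = y ∘ τ.symm := fun τ y => by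
    ext i
    obtain ⟨j, rfl⟩ := τ.surjective i
    rw [MeasurableEquiv.coe_piCongrLeft, Equiv.piCongrLeft_apply_apply]
    simp
  have hsum : ∀ᵐ y : Fin n → ℝ, g y = ∑ τ : Equiv.Perm (Fin n), h (y ∘ τ.symm) := by
    filter_upwards [ae_injective_pi n] with y hy
    rw [Finset.sum_eq_single (Tuple.sort y).symm]
    · rw [hh, Equiv.symm_symm, Set.indicator_of_mem (by exact Tuple.monotone_sort y), hsymm]
    · intro τ _ hτ
      refine Set.indicator_of_notMem (fun hmono => hτ ?_) g
      have := Tuple.unique_monotone hmono (Tuple.monotone_sort y)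
      have h2 : τ.symm = Tuple.sort y := Equiv.ext fun i => hy (congrFun this i)
      rw [← h2, Equiv.symm_symm]
    · simp
  have hint : Integrable h := hg.indicator hmeas
  have hterm : ∀ τ : Equiv.Perm (Fin n), ∫ y : Fin n → ℝ, h (y ∘ τ.symm) = ∫ y, h y := fun τ => by
    simp_rw [← hcomp]
    exact (hmp τ).integral_comp' h
  rw [integral_congr_ae hsum, integral_finsetSum]
  · simp_rw [hterm]
    rw [hh, integral_indicator hmeas]
    simp [Fintype.card_perm]
  · intro τ _
    simp_rw [← hcomp]
    exact (hmp τ).integrable_comp_of_integrable hint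

/-- The left neighbour of `y k` in the list `-1, y 0, y 1, …`. -/
def prevNode {t : ℕ} (y : Fin t → ℝ) (k : Fin t) : ℝ :=
  if h : k.1 = 0 then -1 else y ⟨k.1 - 1, by omega⟩

/-- Monotone tuples with entries in `[-1, 1]`. -/
def orderedCube (n : ℕ) : Set (Fin n → ℝ) :=
  {ξ | Monotone ξ ∧ ∀ i, -1 ≤ ξ i ∧ ξ i ≤ 1}

/-- The enumeration of `Fin (2 * t)` by its even indices and its odd indices. -/
def interleave (t : ℕ) : Fin t ⊕ Fin t ≃ Fin (2 * t) where
  toFun := Sum.elim (fun k => ⟨2 * k.1, by omega⟩) (fun k => ⟨2 * k.1 + 1, by omega⟩)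
  invFun m := if m.1 % 2 = 0 then Sum.inl ⟨m.1 / 2, by omega⟩ else Sum.inr ⟨m.1 / 2, by omega⟩
  left_inv := by
    rintro (k | k)
    · simp
    · simp [Nat.add_mod, show (2 * k.1 + 1) / 2 = k.1 by omega]
  right_inv m := by
    by_cases h : m.1 % 2 = 0
    · simp only [h, if_true, Sum.elim_inl]
      ext; simp only; omega
    · simp only [h, if_false, Sum.elim_inr]
      ext; simp only; omega

theorem orderedCube_eq_inter (n : ℕ) : orderedCube n =
    {ξ : Fin n → ℝ | Monotone ξ} ∩ Set.univ.pi fun _ => Set.Icc (-1 : ℝ) 1 :=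
  Set.ext fun ξ => and_congr_right fun _ => by simp only [Set.mem_univ_pi, Set.mem_Icc]

theorem isClosed_orderedCube (n : ℕ) : IsClosed (orderedCube n) := by
  rw [orderedCube_eq_inter]
  exact isClosed_monotone.inter (isClosed_set_pi fun _ _ => isClosed_Icc)

theorem isCompact_orderedCube (n : ℕ) : IsCompact (orderedCube n) :=
  (isCompact_univ_pi fun _ : Fin n => isCompact_Icc (a := (-1 : ℝ)) (b := 1)).of_isClosed_subset
    (isClosed_orderedCube n) fun _ hξ i _ => hξ.2 i

theorem prevNode_le {t : ℕ} {y : Fin t → ℝ} (hy : y ∈ orderedCube t) (k : Fin t) :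
    prevNode y k ≤ y k := by
  unfold prevNode
  split_ifs with h
  · exact (hy.2 k).1
  · exact hy.1 (Fin.mk_le_of_le_val (by omega))

theorem neg_one_le_prevNode {t : ℕ} {y : Fin t → ℝ} (hy : y ∈ orderedCube t) (k : Fin t) :
    -1 ≤ prevNode y k := by
  unfold prevNode
  split_ifs with h
  · exact le_rfl
  · exact (hy.2 _).1

theorem le_prevNode_of_lt {t : ℕ} {y : Fin t → ℝ} (hy : Monotone y) {a k : Fin t} (h : a < k) :
    y a ≤ prevNode y k := by
  have h' : a.1 < k.1 := h
  rw [prevNode, dif_neg (by omega)]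
  exact hy (Fin.le_def.mpr (by simp only; omega))

theorem sumElim_comp_interleave_symm_mem_orderedCube_iff {t : ℕ} (x y : Fin t → ℝ) :
    Sum.elim x y ∘ (interleave t).symm ∈ orderedCube (2 * t) ↔
      y ∈ orderedCube t ∧ ∀ k, x k ∈ Set.Icc (prevNode y k) (y k) := by
  set ξ := Sum.elim x y ∘ (interleave t).symm with hξ
  have hl : ∀ k : Fin t, ξ ⟨2 * k.1, by omega⟩ = x k := fun k => by
    rw [hξ, Function.comp_apply, show (⟨2 * k.1, by omega⟩ : Fin (2 * t)) =
      interleave t (Sum.inl k) from rfl, Equiv.symm_apply_apply, Sum.elim_inl]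
  have hr : ∀ k : Fin t, ξ ⟨2 * k.1 + 1, by omega⟩ = y k := fun k => by
    rw [hξ, Function.comp_apply, show (⟨2 * k.1 + 1, by omega⟩ : Fin (2 * t)) =
      interleave t (Sum.inr k) from rfl, Equiv.symm_apply_apply, Sum.elim_inr]
  constructor
  · rintro ⟨hm, hb⟩
    refine ⟨⟨fun a b hab => ?_, fun k => hr k ▸ hb _⟩, fun k => ⟨?_, ?_⟩⟩
    · rw [← hr, ← hr]
      have : a.1 ≤ b.1 := hab
      exact hm (Fin.le_def.mpr (by simp only; omega))
    · unfold prevNode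
      split_ifs with h
      · rw [← hl]
        exact (hb _).1
      · rw [← hl, ← hr]
        exact hm (Fin.le_def.mpr (by simp only; omega))
    · rw [← hl, ← hr]
      exact hm (Fin.le_def.mpr (by simp only; omega))
  · rintro ⟨hy, hx⟩
    refine ⟨fun p q hpq => ?_, fun p => ?_⟩
    · obtain ⟨p, rfl⟩ := (interleave t).surjective p
      obtain ⟨q, rfl⟩ := (interleave t).surjective q
      simp only [hξ, Function.comp_apply, Equiv.symm_apply_apply]
      rcases p with a | a <;> rcases q with b | b <;>
        simp only [interleave, Equiv.coe_fn_mk, Sum.elim_inl, Sum.elim_inr, Fin.le_def] at hpq ⊢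
      · rcases (show a ≤ b from Fin.le_def.mpr (by omega)).eq_or_lt with rfl | hab
        · exact le_rfl
        · exact (hx a).2.trans ((le_prevNode_of_lt hy.1 hab).trans (hx b).1)
      · exact (hx a).2.trans (hy.1 (Fin.le_def.mpr (by omega)))
      · exact (le_prevNode_of_lt hy.1 (Fin.lt_def.mpr (by omega))).trans (hx b).1
      · exact hy.1 (Fin.le_def.mpr (by omega))
    · obtain ⟨p, rfl⟩ := (interleave t).surjective p
      simp only [hξ, Function.comp_apply, Equiv.symm_apply_apply]
      rcases p with a | a
      · exact ⟨(neg_one_le_prevNode hy a).trans (hx a).1, (hx a).2.trans (hy.2 a).2⟩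
      · exact hy.2 a

/-- Column operations telescoping the differences of successive nodes. -/
theorem det_fromCols_sub_prevNode {t : ℕ} (Φ : Fin t ⊕ Fin t → ℝ → ℝ)
    (C : Matrix (Fin t ⊕ Fin t) (Fin t) ℝ) (y : Fin t → ℝ) :
    Matrix.det (Matrix.fromCols (Matrix.of fun i k => Φ i (y k) - Φ i (prevNode y k)) C) =
      Matrix.det (Matrix.fromCols (Matrix.of fun i k => Φ i (y k) - Φ i (-1)) C) := by
  set T : Matrix (Fin t) (Fin t) ℝ := Matrix.of fun l k =>
    (if l = k then 1 else 0) - if l.1 + 1 = k.1 then 1 else 0 with hT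
  have hTdet : T.det = 1 := by
    rw [Matrix.det_of_isUpperTriangular]
    · simp [hT]
    · intro l k hlk
      have h : k.1 < l.1 := hlk
      simp [hT, Fin.ext_iff, show l.1 ≠ k.1 by omega, show l.1 + 1 ≠ k.1 by omega]
  have hmul : Matrix.fromCols (Matrix.of fun i k => Φ i (y k) - Φ i (prevNode y k)) C =
      Matrix.fromCols (Matrix.of fun i k => Φ i (y k) - Φ i (-1)) C *
        Matrix.fromBlocks T 0 0 1 := by
    rw [Matrix.fromCols_mul_fromBlocks]
    congr 1
    · ext i k
      simp only [Matrix.mul_zero, add_zero, Matrix.mul_apply, hT, Matrix.of_apply, mul_sub,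
        Finset.sum_sub_distrib, mul_ite, mul_one, mul_zero, Finset.sum_ite_eq', Finset.mem_univ,
        if_true]
      by_cases h : k.1 = 0
      · rw [prevNode, dif_pos h, Finset.sum_eq_zero, sub_zero]
        intro l _
        rw [if_neg (by omega)]
      · rw [prevNode, dif_neg h, Finset.sum_eq_single ⟨k.1 - 1, by omega⟩]
        · rw [if_pos (by simp only; omega)]
          ring
        · intro l _ hl
          rw [if_neg]
          intro h2
          exact hl (Fin.ext (by simp only; omega))
        · simp
    · simp
  rw [hmul, Matrix.det_mul, Matrix.det_fromBlocks_zero₂₁, hTdet]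
  simp

/-- Fubini on the ordered cube: the entries at even indices range over a box determined by the
entries at odd indices. -/
theorem setIntegral_orderedCube_two_mul {t : ℕ} (f : (Fin (2 * t) → ℝ) → ℝ) (hf : Continuous f) :
    ∫ ξ in orderedCube (2 * t), f ξ =
      ∫ y in orderedCube t, ∫ x in Set.univ.pi fun k => Set.Icc (prevNode y k) (y k),
        f (Sum.elim x y ∘ (interleave t).symm) := by
  have hmeas := (isClosed_orderedCube (2 * t)).measurableSet
  have h1 := volume_measurePreserving_piCongrLeft (fun _ => ℝ) (interleave t)
  have h2 := volume_measurePreserving_sumPiEquivProdPi_symm (fun _ : Fin t ⊕ Fin t => ℝ)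
  have hcomp : ∀ z : (Fin t → ℝ) × (Fin t → ℝ),
      MeasurableEquiv.piCongrLeft (fun _ => ℝ) (interleave t)
        ((MeasurableEquiv.sumPiEquivProdPi (fun _ : Fin t ⊕ Fin t => ℝ)).symm z) =
      Sum.elim z.1 z.2 ∘ (interleave t).symm := fun z => by
    ext i
    obtain ⟨j, rfl⟩ := (interleave t).surjective i
    rw [MeasurableEquiv.coe_piCongrLeft, Equiv.piCongrLeft_apply_apply, Function.comp_apply,
      Equiv.symm_apply_apply]
    rcases j with j | j <;> rfl
  have hint : Integrable ((orderedCube (2 * t)).indicator f) :=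
    (hf.continuousOn.integrableOn_compact (isCompact_orderedCube _)).integrable_indicator hmeas
  have hint2 : Integrable (fun z : (Fin t → ℝ) × (Fin t → ℝ) =>
      (orderedCube (2 * t)).indicator f (Sum.elim z.1 z.2 ∘ (interleave t).symm))
      (volume.prod volume) := by
    simp_rw [← hcomp]
    exact h2.integrable_comp_of_integrable (h1.integrable_comp_of_integrable hint)
  rw [← integral_indicator hmeas, ← h1.integral_comp', ← h2.integral_comp']
  simp_rw [hcomp]
  rw [Measure.volume_eq_prod, integral_prod_symm _ hint2,
    ← integral_indicator (isClosed_orderedCube t).measurableSet]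
  congr 1
  ext y
  by_cases hy : y ∈ orderedCube t
  · rw [Set.indicator_of_mem hy, ← integral_indicator (MeasurableSet.univ_pi fun _ =>
      measurableSet_Icc)]
    congr 1
    ext x
    simp only [Set.indicator, sumElim_comp_interleave_symm_mem_orderedCube_iff, hy, true_and,
      Set.mem_univ_pi]
  · rw [Set.indicator_of_notMem hy]
    simp only [Set.indicator, sumElim_comp_interleave_symm_mem_orderedCube_iff, hy, false_and,
      if_false, integral_zero]

/-- De Bruijn's formula for monomials, in terms of the signed sum over pairings. -/
theorem factorial_mul_integral_orderedCube_det {t : ℕ} (n : Fin t ⊕ Fin t → ℕ)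
    (hn : ∀ i, 0 < n i) :
    t.factorial * ∫ ξ in orderedCube (2 * t), Matrix.det (Matrix.of fun i j : Fin t ⊕ Fin t =>
        ξ (interleave t j) ^ (n i - 1)) =
      ∑ σ : Equiv.Perm (Fin t ⊕ Fin t), (Equiv.Perm.sign σ : ℝ) *
        ∏ l, ∫ u in Set.Icc (-1 : ℝ) 1,
          (u ^ n (σ (Sum.inl l)) / n (σ (Sum.inl l)) -
            (-1) ^ n (σ (Sum.inl l)) / n (σ (Sum.inl l))) * u ^ (n (σ (Sum.inr l)) - 1) := by
  set Φ : Fin t ⊕ Fin t → ℝ → ℝ := fun i u => u ^ n i / n i with hΦ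
  set G : (Fin t → ℝ) → ℝ := fun y => Matrix.det (Matrix.fromCols
    (Matrix.of fun i k => Φ i (y k) - Φ i (-1)) (Matrix.of fun i k => y k ^ (n i - 1))) with hG
  have hGcont : Continuous G := by
    refine Continuous.matrix_det (continuous_matrix fun i j => ?_)
    rcases j with k | k <;>
      simp only [Matrix.fromCols_apply_inl, Matrix.fromCols_apply_inr, Matrix.of_apply, hΦ] <;>
      fun_prop
  have hinner : ∀ y ∈ orderedCube t,
      (∫ x in Set.univ.pi fun k => Set.Icc (prevNode y k) (y k),
        Matrix.det (Matrix.of fun i j : Fin t ⊕ Fin t =>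
          (Sum.elim x y ∘ (interleave t).symm) (interleave t j) ^ (n i - 1))) = G y := by
    intro y hy
    have hmat : ∀ x : Fin t → ℝ, (Matrix.of fun i j : Fin t ⊕ Fin t =>
        (Sum.elim x y ∘ (interleave t).symm) (interleave t j) ^ (n i - 1)) =
        Matrix.fromCols (Matrix.of fun i k => x k ^ (n i - 1))
          (Matrix.of fun i k => y k ^ (n i - 1)) := fun x => by
      ext i j
      rcases j with k | k <;> simp
    simp_rw [hmat]
    rw [volume_pi, Measure.restrict_pi_pi,
      integral_det_fromCols _ (fun i u => u ^ (n i - 1)) fun i k =>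
        (continuous_pow _).continuousOn.integrableOn_compact isCompact_Icc]
    refine Eq.trans ?_ (det_fromCols_sub_prevNode Φ _ y)
    congr 3
    ext i k
    rw [integral_Icc_eq_integral_Ioc, ← intervalIntegral.integral_of_le (prevNode_le hy k),
      integral_pow, hΦ]
    have hni := hn i
    simp only
    rw [Nat.sub_add_cancel hni, Nat.cast_sub hni, Nat.cast_one, sub_add_cancel, sub_div]
  have hcube : MeasurableSet (Set.univ.pi fun _ : Fin t => Set.Icc (-1 : ℝ) 1) :=
    MeasurableSet.univ_pi fun _ => measurableSet_Icc
  have hsymm : ∀ (τ : Equiv.Perm (Fin t)) y,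
      (Set.univ.pi fun _ : Fin t => Set.Icc (-1 : ℝ) 1).indicator G (y ∘ τ) =
        (Set.univ.pi fun _ : Fin t => Set.Icc (-1 : ℝ) 1).indicator G y := by
    intro τ y
    have hmem : (y ∘ τ ∈ Set.univ.pi fun _ : Fin t => Set.Icc (-1 : ℝ) 1) ↔
        y ∈ Set.univ.pi fun _ : Fin t => Set.Icc (-1 : ℝ) 1 := by
      simp only [Set.mem_univ_pi, Function.comp_apply]
      exact τ.forall_congr_left.trans (by simp)
    have hGτ : G (y ∘ τ) = G y := by
      have := Matrix.det_permute' (Equiv.Perm.sumCongr τ τ) (Matrix.fromCols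
        (Matrix.of fun i k => Φ i (y k) - Φ i (-1)) (Matrix.of fun i k => y k ^ (n i - 1)))
      rw [Equiv.Perm.sign_sumCongr, Int.units_mul_self, Units.val_one, Int.cast_one,
        one_mul] at this
      refine Eq.trans (congrArg Matrix.det ?_) this
      ext i j
      rcases j with k | k <;> rfl
    by_cases hy : y ∈ Set.univ.pi fun _ : Fin t => Set.Icc (-1 : ℝ) 1
    · rw [Set.indicator_of_mem hy, Set.indicator_of_mem (hmem.mpr hy), hGτ]
    · rw [Set.indicator_of_notMem hy, Set.indicator_of_notMem (mt hmem.mp hy)]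
  have hsym := integral_eq_factorial_mul_setIntegral_monotone _
    ((hGcont.continuousOn.integrableOn_compact
      (isCompact_univ_pi fun _ => isCompact_Icc)).integrable_indicator hcube) hsymm
  rw [integral_indicator hcube, setIntegral_indicator hcube, volume_pi, Measure.restrict_pi_pi,
    ← volume_pi] at hsym
  rw [← orderedCube_eq_inter] at hsym
  rw [setIntegral_orderedCube_two_mul _ (by
      refine Continuous.matrix_det (continuous_matrix fun i j => ?_)
      simp only [Matrix.of_apply]
      fun_prop),
    setIntegral_congr_fun (isClosed_orderedCube t).measurableSet hinner, ← hsym]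
  exact integral_det_fromCols_pair _ (fun i u => Φ i u - Φ i (-1)) (fun i u => u ^ (n i - 1))
    fun i j => (Continuous.continuousOn (by simp only [hΦ]; fun_prop)).integrableOn_compact
      isCompact_Icc

theorem setIntegral_Icc_pow_mul_pow {a b : ℕ} (ha : 0 < a) (hb : 0 < b) :
    ∫ u in Set.Icc (-1 : ℝ) 1, (u ^ a / a - (-1) ^ a / a) * u ^ (b - 1) =
      (1 / a) * ((1 - (-1) ^ (a + b)) / (a + b) - (-1) ^ a * ((1 - (-1) ^ b) / b)) := by
  have h : ∀ u : ℝ, (u ^ a / a - (-1) ^ a / a) * u ^ (b - 1) =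
      (1 / a) * u ^ (a + b - 1) - (-1) ^ a / a * u ^ (b - 1) := fun u => by
    rw [Nat.add_sub_assoc hb, pow_add]
    ring
  simp_rw [h]
  rw [integral_Icc_eq_integral_Ioc, ← intervalIntegral.integral_of_le (by norm_num),
    intervalIntegral.integral_sub (Continuous.intervalIntegrable (by fun_prop) _ _)
      (Continuous.intervalIntegrable (by fun_prop) _ _),
    intervalIntegral.integral_const_mul, intervalIntegral.integral_const_mul, integral_pow,
    integral_pow, Nat.sub_add_cancel hb, Nat.sub_add_cancel (show 1 ≤ a + b by omega),
    Nat.cast_sub hb, Nat.cast_sub (show 1 ≤ a + b by omega)]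
  push_cast
  simp only [sub_add_cancel, one_pow]
  ring

/-- Lemma `Reelllemma` (even case): let `r = 2t` and let `n'_1, …, n'_r` be distinct
positive integers with `n'_1 < n'_3 < ⋯ < n'_{2t-1}` odd and `n'_2 < n'_4 < ⋯ < n'_{2t}`
even (`1`-based positions; the `1`-based position `2k-1` is the `0`-based index `2k.1`
and position `2j` is index `2j.1 + 1`). Then
`∫_{-1 ≤ ξ_1 ≤ ⋯ ≤ ξ_r ≤ 1} det(ξ_k^{n'_j - 1}) dξ
  = 2^r · det( 1/(n'_{2k-1} (n'_{2j} + n'_{2k-1})) )_{1 ≤ j,k ≤ t}`. -/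
theorem integral_ordered_cube_det (t : ℕ) (ht : 1 ≤ t) (n' : Fin (2 * t) → ℕ)
    (hpos : ∀ i, 0 < n' i) (hinj : Function.Injective n')
    (hodd : ∀ k : Fin t, Odd (n' ⟨2 * k.1, by have := k.isLt; omega⟩))
    (heven : ∀ k : Fin t, Even (n' ⟨2 * k.1 + 1, by have := k.isLt; omega⟩))
    (hmonoOdd : StrictMono fun k : Fin t => n' ⟨2 * k.1, by have := k.isLt; omega⟩)
    (hmonoEven : StrictMono fun k : Fin t => n' ⟨2 * k.1 + 1, by have := k.isLt; omega⟩) :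
    (∫ ξ in {ξ : Fin (2 * t) → ℝ | Monotone ξ ∧ ∀ i, -1 ≤ ξ i ∧ ξ i ≤ 1},
      Matrix.det (Matrix.of fun j k : Fin (2 * t) => ξ k ^ (n' j - 1))) =
    2 ^ (2 * t) * Matrix.det (Matrix.of fun j k : Fin t =>
      1 / ((n' ⟨2 * k.1, by have := k.isLt; omega⟩ : ℝ) *
        ((n' ⟨2 * j.1 + 1, by have := j.isLt; omega⟩ : ℝ) +
          (n' ⟨2 * k.1, by have := k.isLt; omega⟩ : ℝ)))) := by
  set n : Fin t ⊕ Fin t → ℕ := n' ∘ interleave t with hn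
  have hnpos : ∀ i, 0 < n i := fun i => hpos _
  have hl : ∀ k, Odd (n (Sum.inl k)) := hodd
  have hr : ∀ k, Even (n (Sum.inr k)) := heven
  let N : Fin t ⊕ Fin t → Fin t ⊕ Fin t → ℝ := fun i j =>
    Sum.elim (fun a => Sum.elim (fun _ => 0)
      (fun b => 4 * (1 / (n (Sum.inl a) * (n (Sum.inr b) + n (Sum.inl a))))) j) (fun _ => 0) i
  have hdet : ∀ ξ : Fin (2 * t) → ℝ,
      Matrix.det (Matrix.of fun j k : Fin (2 * t) => ξ k ^ (n' j - 1)) =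
        Matrix.det (Matrix.of fun i j : Fin t ⊕ Fin t => ξ (interleave t j) ^ (n i - 1)) :=
    fun ξ => (Matrix.det_submatrix_equiv_self (interleave t) _).symm
  simp_rw [hdet]
  have hmain := factorial_mul_integral_orderedCube_det n hnpos
  simp_rw [fun i j => setIntegral_Icc_pow_mul_pow (hnpos i) (hnpos j)] at hmain
  rw [← sum_sign_mul_prod_eq_of_sub_swap_eq (fun i j => (1 / (n i : ℝ)) *
      ((1 - (-1) ^ (n i + n j)) / (n i + n j) - (-1) ^ n i * ((1 - (-1) ^ n j) / n j))) N,
    sum_sign_mul_prod_eq_factorial_mul_det N (fun _ _ => rfl),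
    Fintype.card_fin] at hmain
  · have h := mul_left_cancel₀ (Nat.cast_ne_zero.mpr t.factorial_ne_zero) hmain
    refine h.trans ?_
    rw [← Matrix.det_transpose, pow_mul, show (2 : ℝ) ^ 2 = 4 by norm_num]
    refine Eq.trans ?_ (congrArg (4 ^ · * _) (Fintype.card_fin t))
    rw [← Matrix.det_smul]
    rfl
  · intro i j
    have hi : (n i : ℝ) ≠ 0 := Nat.cast_ne_zero.mpr (hnpos i).ne'
    have hj : (n j : ℝ) ≠ 0 := Nat.cast_ne_zero.mpr (hnpos j).ne'
    have hij : (n i : ℝ) + n j ≠ 0 := by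
      exact_mod_cast (Nat.add_pos_left (hnpos i) _).ne'
    have hji : (n j : ℝ) + n i ≠ 0 := by rwa [add_comm]
    rcases i with a | a <;> rcases j with b | b <;>
      simp only [N, Sum.elim_inl, Sum.elim_inr, pow_add, (hl _).neg_one_pow,
        (hr _).neg_one_pow] <;>
      field_simp <;> ring
end
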